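/- Let (φ,y) be a feasible strategy with traffic rates t satisfying the modified optimality condition. Let (φ†,y†) be any feasible strategy with traffic rates t† such that, for every node i∈V and item k∈C, either y†_i(k) = y_i(k) or t†_i(k) = t_i(k). Then T(φ,y) ≤ T(φ†,y†). -/

import Mathlib

open Finset

noncomputable section

variable {V C : Type*}

/-- Total response flow on link `(a,b)`: `F_{ab} = ∑_k f_{ab}(k)` where `f_{ab}(k) = t_b(k)·φ_{ba}(k)`. -/
def linkFlow [Fintype C] (φ : V → V → C → ℝ) (t : V → C → ℝ) (a b : V) : ℝ :=
  ∑ k, t b k * φ b a k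

/-- Cache size `Y_i = ∑_k y_i(k)`. -/
def cacheSize [Fintype C] (y : V → C → ℝ) (i : V) : ℝ :=
  ∑ k, y i k

/-- Total cost `T(φ,y) = ∑_{(i,j)∈E} D_ij(F_ij) + ∑_i B_i(Y_i)`. -/
def totalCost [Fintype V] [Fintype C] (E : V → V → Prop) [DecidableRel E]
    (D : V → V → ℝ → ℝ) (B : V → ℝ → ℝ)
    (φ : V → V → C → ℝ) (y : V → C → ℝ) (t : V → C → ℝ) : ℝ :=
  (∑ a, ∑ b, if E a b then D a b (linkFlow φ t a b) else 0) + ∑ i, B i (cacheSize y i)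

/-- Feasibility of joint routing/caching strategies. -/
def Feasible [Fintype V] [DecidableEq V] (E : V → V → Prop) (S : C → Finset V)
    (φ : V → V → C → ℝ) (y : V → C → ℝ) : Prop :=
  (∀ i j k, 0 ≤ φ i j k ∧ φ i j k ≤ 1) ∧
  (∀ i j k, ¬ E i j → φ i j k = 0) ∧
  (∀ i k, 0 ≤ y i k ∧ y i k ≤ 1) ∧
  (∀ i k, y i k + ∑ j, φ i j k = if i ∈ S k then 0 else 1)

/-- Traffic equations `t_i(k) = r_i(k) + ∑_j t_j(k) φ_{ji}(k)`, with `t ≥ 0`. -/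
def TrafficEq [Fintype V] (r : V → C → ℝ) (φ : V → V → C → ℝ) (t : V → C → ℝ) : Prop :=
  ∀ i k, 0 ≤ t i k ∧ t i k = r i k + ∑ j, t j k * φ j i k

/-- Marginal recursion `q_i(k) = ∑_{j ∈ N(i)} φ_ij(k) (D'_ji(F_ji) + q_j(k))`. -/
def MarginalEq [Fintype V] [Fintype C] (E : V → V → Prop) [DecidableRel E]
    (D' : V → V → ℝ → ℝ) (φ : V → V → C → ℝ) (t : V → C → ℝ) (q : V → C → ℝ) : Prop :=
  ∀ i k, q i k = ∑ j, if E i j then φ i j k * (D' j i (linkFlow φ t j i) + q j k) else 0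

/-- `δ_i(k)` is the minimum marginal cost, with the convention `B'_i(Y_i)/t_i(k) = +∞` when `t_i(k) = 0`. -/
def IsDelta [Fintype V] [Fintype C] (E : V → V → Prop)
    (D' : V → V → ℝ → ℝ) (B' : V → ℝ → ℝ)
    (φ : V → V → C → ℝ) (y : V → C → ℝ) (t : V → C → ℝ) (q : V → C → ℝ)
    (δ : V → C → ℝ) : Prop :=
  ∀ i k,
    (0 < t i k → δ i k = min (B' i (cacheSize y i) / t i k)
      (sInf {x : ℝ | ∃ j, E i j ∧ x = D' j i (linkFlow φ t j i) + q j k})) ∧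
    (t i k = 0 → δ i k = sInf {x : ℝ | ∃ j, E i j ∧ x = D' j i (linkFlow φ t j i) + q j k})

/-- Caching part of the modified optimality condition. -/
def CacheCond [Fintype C] (B' : V → ℝ → ℝ) (y : V → C → ℝ) (t : V → C → ℝ)
    (δ : V → C → ℝ) : Prop :=
  ∀ i k, (0 < y i k → B' i (cacheSize y i) = t i k * δ i k) ∧
    (y i k = 0 → t i k * δ i k ≤ B' i (cacheSize y i))

/-- Routing part of the modified optimality condition. -/
def RouteCond [Fintype C] (E : V → V → Prop) (D' : V → V → ℝ → ℝ)
    (φ : V → V → C → ℝ) (t : V → C → ℝ) (q : V → C → ℝ) (δ : V → C → ℝ) : Prop :=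
  ∀ i k, ∀ j, E i j →
    (0 < φ i j k → D' j i (linkFlow φ t j i) + q j k = δ i k) ∧
    (φ i j k = 0 → δ i k ≤ D' j i (linkFlow φ t j i) + q j k)

/-- Link costs: continuously differentiable (with derivative `D'`), nondecreasing, convex, `D(0)=0`, nonnegative. -/
def LinkCostReg (D D' : V → V → ℝ → ℝ) : Prop :=
  ∀ a b, (∀ x, HasDerivAt (D a b) (D' a b x) x) ∧ MonotoneOn (D a b) (Set.Ici 0) ∧
    ConvexOn ℝ (Set.Ici 0) (D a b) ∧ D a b 0 = 0 ∧ ∀ x, 0 ≤ x → 0 ≤ D a b x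

/-- Cache deployment costs: continuously differentiable (with derivative `B'`), nondecreasing, convex, `B(0)=0`, nonnegative. -/
def CacheCostReg (B B' : V → ℝ → ℝ) : Prop :=
  ∀ i, (∀ x, HasDerivAt (B i) (B' i x) x) ∧ MonotoneOn (B i) (Set.Ici 0) ∧
    ConvexOn ℝ (Set.Ici 0) (B i) ∧ B i 0 = 0 ∧ ∀ x, 0 ≤ x → 0 ≤ B i x

/-- Loop-free routing: for every item, the support digraph of `φ` is acyclic. -/
def LoopFree (φ : V → V → C → ℝ) : Prop :=
  ∀ k, ¬ ∃ (n : ℕ) (c : ℕ → V), 0 < n ∧ c 0 = c n ∧ ∀ l < n, 0 < φ (c l) (c (l + 1)) k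

/-- A convex function on `[0, ∞)` lies above its tangent lines. -/
lemma ConvexOn.tangent_le_of_hasDerivAt {f : ℝ → ℝ} {s : Set ℝ} {f' u v : ℝ}
    (hf : ConvexOn ℝ s f) (hd : HasDerivAt f f' u) (hu : u ∈ s) (hv : v ∈ s) :
    f u + f' * (v - u) ≤ f v := by
  rcases lt_trichotomy u v with h | rfl | h
  · have := hf.le_slope_of_hasDerivAt hu hv h hd
    rw [slope_def_field, le_div_iff₀ (sub_pos.2 h)] at this
    linarith
  · simp
  · have := hf.slope_le_of_hasDerivAt hv hu h hd
    rw [slope_def_field, div_le_iff₀ (sub_pos.2 h)] at this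
    linarith

lemma linkFlow_nonneg [Fintype C] {φ : V → V → C → ℝ} {t : V → C → ℝ}
    (hφ : ∀ i j k, 0 ≤ φ i j k) (ht : ∀ i k, 0 ≤ t i k) (a b : V) : 0 ≤ linkFlow φ t a b :=
  sum_nonneg fun k _ => mul_nonneg (ht b k) (hφ b a k)

/-- Flow conservation, tested against a potential `p`. -/
lemma sum_flow_mul_potential [Fintype V] {r t : V → ℝ} {φ : V → V → ℝ}
    (h : ∀ i, t i = r i + ∑ j, t j * φ j i) (p : V → ℝ) :
    ∑ i, ∑ j, t i * φ i j * p j = ∑ j, (t j - r j) * p j := by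
  rw [sum_comm]
  refine sum_congr rfl fun j _ => ?_
  rw [← sum_mul, h j, add_sub_cancel_left]

/-- Single-item comparison of linearized routing costs: if every used link attains the minimal
marginal cost `δ`, then changing the routing changes the linearized cost by at least the value of
the traffic no longer cached. -/
lemma sum_traffic_mul_delta_le [Fintype V] {r t t' q δ y y' s : V → ℝ} {φ φ' w : V → V → ℝ}
    (ht : ∀ i, t i = r i + ∑ j, t j * φ j i) (ht' : ∀ i, t' i = r i + ∑ j, t' j * φ' j i)
    (ht'0 : ∀ i, 0 ≤ t' i)
    (hy : ∀ i, y i + ∑ j, φ i j = s i) (hy' : ∀ i, y' i + ∑ j, φ' i j = s i)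
    (hq : ∀ i, q i = ∑ j, φ i j * (w i j + q j))
    (hδ : ∀ i j, φ i j * (w i j + q j) = φ i j * δ i)
    (hδ' : ∀ i j, φ' i j * δ i ≤ φ' i j * (w i j + q j)) :
    ∑ i, t' i * δ i * (y i - y' i) ≤ ∑ i, ∑ j, (t' i * φ' i j - t i * φ i j) * w i j := by
  have hqδ (i : V) : q i = δ i * (s i - y i) := by
    rw [hq, sum_congr rfl fun j _ => hδ i j, ← sum_mul, ← hy i]
    ring
  have hcost : ∑ i, ∑ j, t i * φ i j * w i j = ∑ j, r j * q j := by
    have h : ∑ i, ∑ j, t i * φ i j * (w i j + q j) = ∑ i, t i * q i :=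
      sum_congr rfl fun i _ => by rw [hq i, mul_sum]; simp only [mul_assoc]
    simp only [mul_add, sum_add_distrib, sum_flow_mul_potential ht, sub_mul,
      sum_sub_distrib] at h
    linarith
  have hcost' : ∑ i, t' i * (δ i * (s i - y' i)) - ∑ j, (t' j - r j) * q j ≤
      ∑ i, ∑ j, t' i * φ' i j * w i j := by
    have h : ∑ i, t' i * (δ i * (s i - y' i)) ≤ ∑ i, ∑ j, t' i * φ' i j * (w i j + q j) := by
      refine sum_le_sum fun i _ => ?_
      simp only [mul_assoc]
      rw [← mul_sum]
      refine mul_le_mul_of_nonneg_left ?_ (ht'0 i)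
      rw [← hy' i, add_sub_cancel_left, mul_comm, sum_mul]
      exact sum_le_sum fun j _ => hδ' i j
    simp only [mul_add, sum_add_distrib, sum_flow_mul_potential ht'] at h
    linarith
  have hsplit : ∑ i, t' i * δ i * (y i - y' i) =
      ∑ i, t' i * (δ i * (s i - y' i)) - ∑ j, (t' j - r j) * q j - ∑ j, r j * q j := by
    rw [← sum_sub_distrib, ← sum_sub_distrib]
    exact sum_congr rfl fun i _ => by rw [hqδ i]; ring
  simp only [sub_mul, sum_sub_distrib]
  linarith

/-- Corollary 2: if `(φ,y)` satisfies the modified condition and `(φ†,y†)`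
is feasible with, for every `i,k`, either `y†_i(k) = y_i(k)` or `t†_i(k) = t_i(k)`, then
`T(φ,y) ≤ T(φ†,y†)`. -/
theorem modified_condition_partial_optimality
    {V C : Type*} [Fintype V] [Fintype C] [DecidableEq V]
    (E : V → V → Prop) [DecidableRel E] (hEsymm : ∀ i j, E i j → E j i)
    (hN : ∀ i, ∃ j, E i j)
    (S : C → Finset V) (r : V → C → ℝ) (hr : ∀ i k, 0 ≤ r i k)
    (D D' : V → V → ℝ → ℝ) (B B' : V → ℝ → ℝ)
    (hD : LinkCostReg D D') (hB : CacheCostReg B B')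
    (φ : V → V → C → ℝ) (y : V → C → ℝ) (t q δ : V → C → ℝ)
    (hfeas : Feasible E S φ y) (htraffic : TrafficEq r φ t)
    (hq : MarginalEq E D' φ t q)
    (hδ : IsDelta E D' B' φ y t q δ)
    (hcache : CacheCond B' y t δ) (hroute : RouteCond E D' φ t q δ)
    (φ' : V → V → C → ℝ) (y' : V → C → ℝ) (t' : V → C → ℝ)
    (hfeas' : Feasible E S φ' y') (htraffic' : TrafficEq r φ' t')
    (hcmp : ∀ i k, y' i k = y i k ∨ t' i k = t i k) :
    totalCost E D B φ y t ≤ totalCost E D B φ' y' t' := by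
  obtain ⟨hφ, hφE, hy, hys⟩ := hfeas
  obtain ⟨hφ', hφE', hy', hys'⟩ := hfeas'
  have hF := linkFlow_nonneg (fun i j k => (hφ i j k).1) (fun i k => (htraffic i k).1)
  have hF' := linkFlow_nonneg (fun i j k => (hφ' i j k).1) (fun i k => (htraffic' i k).1)
  let w : V → V → ℝ := fun i j => D' j i (linkFlow φ t j i)
  have hlink (a b : V) :
      (if E a b then D a b (linkFlow φ t a b) else 0) +
        ∑ k, (t' b k * φ' b a k - t b k * φ b a k) * w b a ≤
      if E a b then D a b (linkFlow φ' t' a b) else 0 := by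
    split_ifs with h
    · obtain ⟨hd, -, hconv, -⟩ := hD a b
      have := hconv.tangent_le_of_hasDerivAt (hd _) (hF a b) (hF' a b)
      rw [← sum_mul, sum_sub_distrib, mul_comm]
      exact this
    · have hba : ¬ E b a := fun h' => h (hEsymm _ _ h')
      simp [hφE _ _ _ hba, hφE' _ _ _ hba]
  have hnode (i : V) :
      B i (cacheSize y i) + ∑ k, B' i (cacheSize y i) * (y' i k - y i k) ≤
        B i (cacheSize y' i) := by
    obtain ⟨hd, -, hconv, -⟩ := hB i
    have := hconv.tangent_le_of_hasDerivAt (hd _)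
      (sum_nonneg fun k _ => (hy i k).1 : 0 ≤ cacheSize y i)
      (sum_nonneg fun k _ => (hy' i k).1 : 0 ≤ cacheSize y' i)
    rw [← mul_sum, sum_sub_distrib]
    exact this
  have hcaching (i : V) (k : C) :
      t' i k * δ i k * (y' i k - y i k) ≤ B' i (cacheSize y i) * (y' i k - y i k) := by
    rcases hcmp i k with h | h
    · simp [h]
    · rw [h]
      rcases (hy i k).1.eq_or_lt with h0 | h0
      · rw [← h0, sub_zero]
        exact mul_le_mul_of_nonneg_right ((hcache i k).2 h0.symm) (hy' i k).1
      · rw [(hcache i k).1 h0]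
  have hrouting (k : C) : ∑ i, t' i k * δ i k * (y i k - y' i k) ≤
      ∑ i, ∑ j, (t' i k * φ' i j k - t i k * φ i j k) * w i j := by
    refine sum_traffic_mul_delta_le (q := fun i => q i k) (fun i => (htraffic i k).2)
      (fun i => (htraffic' i k).2) (fun i => (htraffic' i k).1) (fun i => hys i k)
      (fun i => hys' i k) (fun i => ?_) (fun i j => ?_) (fun i j => ?_)
    · rw [hq i k]
      refine sum_congr rfl fun j _ => ?_
      split_ifs with h
      · rfl
      · rw [hφE _ _ _ h, zero_mul]
    · rcases (hφ i j k).1.eq_or_lt with h0 | h0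
      · simp [← h0]
      · have h : E i j := by
          by_contra h
          exact h0.ne' (hφE _ _ _ h)
        rw [← (hroute i k j h).1 h0]
    · by_cases h : E i j
      · refine mul_le_mul_of_nonneg_left ?_ (hφ' i j k).1
        rcases (hφ i j k).1.eq_or_lt with h0 | h0
        · exact (hroute i k j h).2 h0.symm
        · exact ((hroute i k j h).1 h0).ge
      · simp [hφE' _ _ _ h]
  have hlinks := sum_le_sum fun a (_ : a ∈ univ) => sum_le_sum fun b (_ : b ∈ univ) => hlink a b
  have hnodes := sum_le_sum fun i (_ : i ∈ univ) => hnode i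
  simp only [sum_add_distrib] at hlinks hnodes
  have hcachings := sum_le_sum fun i (_ : i ∈ univ) =>
    sum_le_sum fun k (_ : k ∈ univ) => hcaching i k
  have hroutings := sum_le_sum fun k (_ : k ∈ univ) => hrouting k
  have hswap : ∑ k, ∑ i, ∑ j, (t' i k * φ' i j k - t i k * φ i j k) * w i j =
      ∑ a, ∑ b, ∑ k, (t' b k * φ' b a k - t b k * φ b a k) * w b a := by
    rw [sum_comm]
    simp_rw [sum_comm (s := (univ : Finset C))]
    exact sum_comm
  have hneg : ∑ k, ∑ i, t' i k * δ i k * (y i k - y' i k) =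
      -∑ i, ∑ k, t' i k * δ i k * (y' i k - y i k) := by
    rw [sum_comm]
    simp only [← sum_neg_distrib, ← mul_neg, neg_sub]
  unfold totalCost
  linarith
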